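/- Let N, M ≥ 1, let w ∈ ℝ^M with W = diag(w₁,…,w_M), let Φ ∈ ℝ^{M×N}, let A, B ∈ ℝ^{N×N} be symmetric matrices with A invertible, let F : ℝ → ℝ, and let τ ≠ 0. Suppose α, α⁺, β, β⁺ ∈ ℝ^N and q ∈ ℝ^M satisfy: (i) q_j · ((Φα⁺)_j − (Φα)_j) = F((Φα⁺)_j) − F((Φα)_j) for every j = 1,…,M; (ii) (1/τ)(α⁺ − α) = ½(β + β⁺); and (iii) (1/τ)(β⁺ − β) = −½ A⁻¹ B (α + α⁺) − A⁻¹ Φᵀ W q. Then ½ (β⁺)ᵀ A β⁺ + ½ (α⁺)ᵀ B α⁺ + Σ_{j=1}^M w_j F((Φα⁺)_j) = ½ βᵀ A β + ½ αᵀ B α + Σ_{j=1}^M w_j F((Φα)_j). -/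

import Mathlib

open Matrix

/-- A symmetric bilinear form is symmetric in its vector arguments. -/
theorem Matrix.IsSymm.dotProduct_mulVec_comm {n R : Type*} [Fintype n] [CommRing R]
    {S : Matrix n n R} (hS : S.IsSymm) (x y : n → R) :
    x ⬝ᵥ S *ᵥ y = y ⬝ᵥ S *ᵥ x := by
  rw [dotProduct_mulVec, ← mulVec_transpose, hS.eq, dotProduct_comm]

/-- Difference of squares for the quadratic form of a symmetric matrix. -/
theorem Matrix.IsSymm.add_dotProduct_mulVec_sub {n R : Type*} [Fintype n] [CommRing R]
    {S : Matrix n n R} (hS : S.IsSymm) (x y : n → R) :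
    (x + y) ⬝ᵥ S *ᵥ (y - x) = y ⬝ᵥ S *ᵥ y - x ⬝ᵥ S *ᵥ x := by
  rw [mulVec_sub, dotProduct_sub, add_dotProduct, add_dotProduct,
    hS.dotProduct_mulVec_comm x y]
  ring

/-- Theorem 4.3: one step of the second-order average vector field (AVF)
discretization of the meshless Galerkin system exactly conserves the discrete
energy `E^d(α,β) = ½βᵀAβ + ½αᵀBα + Σⱼ wⱼ F((Φα)ⱼ)`. -/
theorem avf_step_conserves_discrete_energy
    {N M : ℕ} (hN : 1 ≤ N) (hM : 1 ≤ M)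
    (w : Fin M → ℝ)
    (Φ : Matrix (Fin M) (Fin N) ℝ)
    (A B : Matrix (Fin N) (Fin N) ℝ)
    (hAsymm : A.IsSymm) (hBsymm : B.IsSymm) (hAinv : IsUnit A)
    (F : ℝ → ℝ) (τ : ℝ) (hτ : τ ≠ 0)
    (α αp β βp : Fin N → ℝ) (q : Fin M → ℝ)
    (hq : ∀ j : Fin M,
      q j * (Φ.mulVec αp j - Φ.mulVec α j)
        = F (Φ.mulVec αp j) - F (Φ.mulVec α j))
    (h1 : (1 / τ) • (αp - α) = (1 / 2 : ℝ) • (β + βp))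
    (h2 : (1 / τ) • (βp - β)
        = -((1 / 2 : ℝ) • (A⁻¹ * B).mulVec (α + αp))
          - A⁻¹.mulVec (Φᵀ.mulVec ((Matrix.diagonal w).mulVec q))) :
    (1 / 2) * (βp ⬝ᵥ A.mulVec βp) + (1 / 2) * (αp ⬝ᵥ B.mulVec αp)
        + ∑ j : Fin M, w j * F (Φ.mulVec αp j)
      = (1 / 2) * (β ⬝ᵥ A.mulVec β) + (1 / 2) * (α ⬝ᵥ B.mulVec α)
        + ∑ j : Fin M, w j * F (Φ.mulVec α j) := by
  have hdet : IsUnit A.det := (isUnit_iff_isUnit_det A).mp hAinv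
  have momentum : (1 / τ) • A *ᵥ (βp - β)
      = -((1 / 2 : ℝ) • B *ᵥ (α + αp)) - Φᵀ *ᵥ (diagonal w *ᵥ q) := by
    rw [← mulVec_smul, h2, mulVec_sub, mulVec_neg, mulVec_smul, mulVec_mulVec,
      mulVec_mulVec, ← Matrix.mul_assoc, mul_nonsing_inv A hdet, Matrix.one_mul,
      Matrix.one_mulVec]
  have kinetic : (αp - α) ⬝ᵥ (1 / τ) • A *ᵥ (βp - β)
      = (1 / 2) * (βp ⬝ᵥ A *ᵥ βp - β ⬝ᵥ A *ᵥ β) := by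
    rw [dotProduct_smul, ← smul_dotProduct, h1, smul_dotProduct,
      hAsymm.add_dotProduct_mulVec_sub, smul_eq_mul]
  have elastic : (αp - α) ⬝ᵥ B *ᵥ (α + αp) = αp ⬝ᵥ B *ᵥ αp - α ⬝ᵥ B *ᵥ α := by
    rw [hBsymm.dotProduct_mulVec_comm, hBsymm.add_dotProduct_mulVec_sub]
  have potential : (αp - α) ⬝ᵥ Φᵀ *ᵥ (diagonal w *ᵥ q)
      = ∑ j, w j * F ((Φ *ᵥ αp) j) - ∑ j, w j * F ((Φ *ᵥ α) j) := by
    rw [dotProduct_mulVec, vecMul_transpose, mulVec_sub, ← Finset.sum_sub_distrib]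
    refine Finset.sum_congr rfl fun j _ => ?_
    rw [mulVec_diagonal, Pi.sub_apply, ← mul_sub, ← hq j]
    ring
  rw [momentum, dotProduct_sub, dotProduct_neg, dotProduct_smul, elastic, potential,
    smul_eq_mul] at kinetic
  linarith
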